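/- Let J denote the 2n×2n block matrix [[0, −Iₙ],[Iₙ, 0]]. Let r ≥ 1 and for each ν ∈ {1,…,r} and n ∈ ℕ let A^{(ν,n)} be a real 2n×2n matrix with (A^{(ν,n)}J)ᵀ = −A^{(ν,n)}J. Assume that for all μ,ν ∈ {1,…,r} the limit c_{μν} := lim_{n→∞} (1/n)·Tr(A^{(μ,n)}(A^{(ν,n)})ᵀ) exists, and that c_{νν} > 0 for each ν. Let g^{(n)} be a Haar-distributed random element of O(2n) and set V^{(n)} := g^{(n)}Jᵀ(g^{(n)})ᵀJ. Then, as n → ∞, the random vector (Tr(A^{(1,n)}V^{(n)}), …, Tr(A^{(r,n)}V^{(n)})) converges in distribution to the centered Gaussian distribution on ℝ^r with covariance matrix (c_{μν}). -/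

import Mathlib

open MeasureTheory ProbabilityTheory Matrix Filter Topology

/-- Matrices inherit the product measurable structure. -/
instance matrixMeasurableSpace {m n α : Type*} [MeasurableSpace α] :
    MeasurableSpace (Matrix m n α) :=
  inferInstanceAs (MeasurableSpace (m → n → α))

/-- `γ` is the Gaussian distribution on `ℝ^r` with mean vector `m` and covariance
matrix `C`, characterized via its one-dimensional linear projections (Cramér–Wold). -/
def IsGaussianMeasure {r : ℕ} (γ : Measure (Fin r → ℝ)) (m : Fin r → ℝ)
    (C : Matrix (Fin r) (Fin r) ℝ) : Prop :=
  IsProbabilityMeasure γ ∧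
    ∀ t : Fin r → ℝ,
      γ.map (fun x => ∑ i, t i * x i) =
        gaussianReal (∑ i, t i * m i)
          (Real.toNNReal (∑ i, ∑ j, t i * C i j * t j))

/-- The real `2n×2n` block matrix `J = [[0, -Iₙ],[Iₙ, 0]]`. -/
def Jmat (n : ℕ) : Matrix (Fin n ⊕ Fin n) (Fin n ⊕ Fin n) ℝ :=
  Matrix.fromBlocks 0 (-1) 1 0

namespace DIII
open scoped Matrix.Norms.Operator

instance matrixBorelSpace {m n : Type*} [Fintype m] [Fintype n] :
    BorelSpace (Matrix m n ℝ) :=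
  inferInstanceAs (BorelSpace (m → n → ℝ))

instance orthBorel {ι : Type*} [Fintype ι] [DecidableEq ι] :
    BorelSpace (Matrix.orthogonalGroup ι ℝ) := Subtype.borelSpace _

instance orthSC {ι : Type*} [Fintype ι] [DecidableEq ι] :
    SecondCountableTopology (Matrix.orthogonalGroup ι ℝ) := by
  have : SecondCountableTopology (Matrix ι ι ℝ) :=
    inferInstanceAs (SecondCountableTopology (ι → ι → ℝ))
  exact TopologicalSpace.Subtype.secondCountableTopology _

instance orthMM {ι : Type*} [Fintype ι] [DecidableEq ι] :
    MeasurableMul (Matrix.orthogonalGroup ι ℝ) := inferInstance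

instance orthCompact {ι : Type*} [Fintype ι] [DecidableEq ι] :
    CompactSpace (Matrix.orthogonalGroup ι ℝ) := by
  suffices h : IsCompact (Matrix.orthogonalGroup ι ℝ : Set (Matrix ι ι ℝ)) from
    isCompact_iff_compactSpace.mp h
  have hc : IsCompact (Set.pi Set.univ (fun _ : ι => Set.pi Set.univ
      (fun _ : ι => Set.Icc (-1 : ℝ) 1))) :=
    isCompact_univ_pi fun _ => isCompact_univ_pi fun _ => isCompact_Icc
  refine IsCompact.of_isClosed_subset hc ?_ ?_
  · have : (Matrix.orthogonalGroup ι ℝ : Set (Matrix ι ι ℝ)) = {M | M * Mᵀ = 1} := by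
      ext M; exact Matrix.mem_orthogonalGroup_iff ι ℝ
    rw [this]
    exact isClosed_eq (by fun_prop) continuous_const
  · intro M hM i _ j _
    have := entry_norm_bound_of_unitary (𝕜 := ℝ) hM i j
    exact abs_le.mp this

variable {ι : Type*} [Fintype ι] [DecidableEq ι]

/-- the conjugated matrix -/
def XX (K : Matrix ι ι ℝ) (g : Matrix.orthogonalGroup ι ℝ) : Matrix ι ι ℝ :=
  (g : Matrix ι ι ℝ) * K * (g : Matrix ι ι ℝ)ᵀ

lemma continuous_XX (K : Matrix ι ι ℝ) : Continuous (XX K) := by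
  unfold XX
  have : Continuous (fun g : Matrix.orthogonalGroup ι ℝ => (g : Matrix ι ι ℝ)) :=
    continuous_subtype_val
  fun_prop

lemma ibp {E : Type*} [NormedAddCommGroup E] [NormedSpace ℝ E]
    [SecondCountableTopology E]
    (μ : Measure (Matrix.orthogonalGroup ι ℝ)) [IsProbabilityMeasure μ]
    [μ.IsMulLeftInvariant] (K Y : Matrix ι ι ℝ) (hY : Yᵀ = -Y)
    (F F' : Matrix ι ι ℝ → E) (hFc : Continuous F) (hF'c : Continuous F')
    (hF : ∀ (γ : ℝ → Matrix ι ι ℝ) (θ : ℝ), HasDerivAt γ (Y * γ θ - γ θ * Y) θ →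
      HasDerivAt (fun s => F (γ s)) (F' (γ θ)) θ) :
    ∫ g, F' (XX K g) ∂μ = 0 := by
  have hmem : ∀ θ : ℝ, NormedSpace.exp (θ • Y) ∈ Matrix.orthogonalGroup ι ℝ := by
    intro θ
    rw [Matrix.mem_orthogonalGroup_iff, 
      ← Matrix.exp_transpose, transpose_smul, hY, smul_neg, ← Matrix.exp_add_of_commute,
      add_neg_cancel, NormedSpace.exp_zero]
    exact (Commute.refl _).neg_right
  let R : ℝ → Matrix.orthogonalGroup ι ℝ := fun θ => ⟨_, hmem θ⟩
  have hR0 : R 0 = 1 := by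
    apply Subtype.ext
    simp [R]
  have hXR : ∀ θ g, XX K (R θ * g) =
      NormedSpace.exp (θ • Y) * XX K g * NormedSpace.exp (θ • (-Y)) := by
    intro θ g
    simp only [XX, R, Submonoid.coe_mul, transpose_mul, ← Matrix.exp_transpose, transpose_smul, hY,
      Matrix.mul_assoc]
  have hd : ∀ θ g, HasDerivAt (fun s => XX K (R s * g))
      (Y * XX K (R θ * g) - XX K (R θ * g) * Y) θ := by
    intro θ g
    simp only [hXR]
    have h1 := hasDerivAt_exp_smul_const' (𝕂 := ℝ) Y θ
    have h2 := hasDerivAt_exp_smul_const (𝕂 := ℝ) (-Y) θ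
    have h3 := (h1.mul_const (XX K g)).mul h2
    refine HasDerivAt.congr_deriv h3 ?_
    rw [mul_neg, mul_neg, sub_eq_add_neg]
    simp only [Matrix.mul_assoc]
    rfl
  obtain ⟨C, hC⟩ : ∃ C, ∀ g, ‖F' (XX K g)‖ ≤ C := by
    have := isCompact_univ.exists_bound_of_continuousOn
      (hF'c.comp (continuous_XX K)).continuousOn
    obtain ⟨C, hC⟩ := this
    exact ⟨C, fun g => hC g trivial⟩
  have hmeas : ∀ θ, AEStronglyMeasurable (fun g => F (XX K (R θ * g))) μ := fun θ =>
    (hFc.comp ((continuous_XX K).comp (continuous_const_mul (R θ)))).aestronglyMeasurable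
  have hFint : Integrable (fun g => F (XX K (R 0 * g))) μ := by
    have hcont := (hFc.comp ((continuous_XX K).comp (continuous_const_mul (R 0))))
    obtain ⟨D, hD⟩ := isCompact_univ.exists_bound_of_continuousOn hcont.continuousOn
    exact Integrable.of_bound (hmeas 0) D (ae_of_all _ fun g => hD g trivial)
  have key := hasDerivAt_integral_of_dominated_loc_of_deriv_le (μ := μ) (s := Set.univ)
    (F := fun θ g => F (XX K (R θ * g))) (F' := fun θ g => F' (XX K (R θ * g)))
    (x₀ := (0 : ℝ)) (bound := fun _ => C) univ_mem (Eventually.of_forall hmeas) hFint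
    (hF'c.comp ((continuous_XX K).comp (continuous_const_mul (R 0)))).aestronglyMeasurable
    (ae_of_all _ fun g θ _ => hC _) (integrable_const C)
    (ae_of_all _ fun g θ _ => hF _ θ (hd θ g))
  have h2 := key.2
  have hconst : (fun θ => ∫ g, F (XX K (R θ * g)) ∂μ) = fun _ => ∫ g, F (XX K g) ∂μ := by
    funext θ
    exact integral_mul_left_eq_self (fun g => F (XX K g)) (R θ)
  rw [hconst] at h2
  have := h2.unique (hasDerivAt_const _ _)
  simpa [hR0] using this

end DIII
open MeasureTheory ProbabilityTheory Matrix Filter Topology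
namespace DIII
variable {ι : Type*} [Fintype ι] [DecidableEq ι]

/-- elementary skew-symmetric matrix -/
def Yab (a b : ι) : Matrix ι ι ℝ := Matrix.single a b 1 - Matrix.single b a 1

lemma Yab_transpose (a b : ι) : (Yab a b)ᵀ = - Yab a b := by
  simp [Yab, transpose_sub]

lemma trace_Yab (a b : ι) (P : Matrix ι ι ℝ) : (Yab a b * P).trace = P b a - P a b := by
  simp [Yab, Matrix.sub_mul, trace_sub, Matrix.trace_single_mul]

lemma trace_single_quad (a b c d : ι) (P Q : Matrix ι ι ℝ) :
    (Matrix.single a b 1 * P * Matrix.single c d 1 * Q).trace = P b c * Q d a := by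
  rw [Matrix.mul_assoc, Matrix.mul_assoc, Matrix.trace_single_mul]
  simp [Matrix.mul_apply, Matrix.single_apply, ite_and, Finset.sum_ite_eq]

lemma trace_Yab_quad (a b : ι) (P Q : Matrix ι ι ℝ) :
    (Yab a b * P * Yab a b * Q).trace =
      P b a * Q b a - P b b * Q a a - P a a * Q b b + P a b * Q a b := by
  simp only [Yab, Matrix.sub_mul, Matrix.mul_sub, trace_sub, trace_single_quad]
  ring

lemma sum_quad (P Q : Matrix ι ι ℝ) :
    ∑ a, ∑ b, (Yab a b * P * Yab a b * Q).trace =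
      2 * ((Pᵀ * Q).trace - P.trace * Q.trace) := by
  simp only [trace_Yab_quad, Finset.sum_add_distrib, Finset.sum_sub_distrib]
  have h1 : (Pᵀ * Q).trace = ∑ a, ∑ b, P b a * Q b a := by
    simp [Matrix.trace, Matrix.mul_apply]
  have h2 : ∑ a, ∑ b, P a b * Q a b = ∑ a, ∑ b, P b a * Q b a := Finset.sum_comm
  have h3 : P.trace * Q.trace = ∑ a, ∑ b, P a a * Q b b := by
    simp [Matrix.trace, Finset.sum_mul_sum]
  have h4 : ∑ a, ∑ b, P b b * Q a a = ∑ a, ∑ b, P a a * Q b b := Finset.sum_comm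
  rw [h1, h2, h3, h4]; ring

lemma sum_sq (P : Matrix ι ι ℝ) :
    ∑ a, ∑ b, (Yab a b * P).trace ^ 2 = 2 * (P * Pᵀ).trace - 2 * (P * P).trace := by
  have e : ∀ a b, (Yab a b * P).trace ^ 2 = P b a * P b a - 2 * (P a b * P b a) + P a b * P a b := by
    intro a b; rw [trace_Yab]; ring
  simp only [e, Finset.sum_add_distrib, Finset.sum_sub_distrib, ← Finset.mul_sum]
  have h1 : (P * Pᵀ).trace = ∑ a, ∑ b, P a b * P a b := by
    simp [Matrix.trace, Matrix.mul_apply]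
  have h2 : ∑ a, ∑ b, P b a * P b a = ∑ a, ∑ b, P a b * P a b := Finset.sum_comm
  have h3 : (P * P).trace = ∑ a, ∑ b, P a b * P b a := by
    simp [Matrix.trace, Matrix.mul_apply]
  rw [h1, h2, h3]; ring

/-- first derivative of `Tr (B X)` in direction `Y` -/
def D1 (B Y X : Matrix ι ι ℝ) : ℝ := (B * (Y * X - X * Y)).trace

/-- second derivative -/
def D2 (B Y X : Matrix ι ι ℝ) : ℝ := (B * (Y * (Y * X - X * Y) - (Y * X - X * Y) * Y)).trace

lemma sum_D2 (B X : Matrix ι ι ℝ) (hX : Xᵀ = -X) (hB : Bᵀ = -B) :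
    ∑ a, ∑ b, D2 B (Yab a b) X = -4 * ((Fintype.card ι : ℝ) - 2) * (B * X).trace := by
  have e : ∀ Y, D2 B Y X = (Y * 1 * Y * (X * B)).trace - 2 * (Y * X * Y * B).trace
      + (Y * 1 * Y * (B * X)).trace := by
    intro Y
    have h1 : (Y * 1 * Y * (X * B)).trace = (B * (Y * (Y * X))).trace := by
      rw [Matrix.mul_one, ← Matrix.mul_assoc, Matrix.trace_mul_comm, Matrix.mul_assoc Y Y X]
    have h2 : (Y * X * Y * B).trace = (B * (Y * (X * Y))).trace := by
      rw [Matrix.trace_mul_comm, Matrix.mul_assoc Y X Y]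
    have h3 : (Y * 1 * Y * (B * X)).trace = (B * (X * Y * Y)).trace := by
      rw [Matrix.mul_one, Matrix.trace_mul_comm]; simp only [Matrix.mul_assoc]
    rw [h1, h2, h3, D2]
    simp only [Matrix.mul_sub, Matrix.sub_mul, trace_sub, Matrix.mul_assoc]
    ring
  have tX : X.trace = 0 := by
    have := congrArg trace hX
    rw [trace_transpose, trace_neg] at this; linarith
  simp only [e, Finset.sum_add_distrib, Finset.sum_sub_distrib, ← Finset.mul_sum, sum_quad]
  rw [hX, tX, trace_mul_comm X B, Matrix.neg_mul, trace_neg, trace_mul_comm X B]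
  simp only [transpose_one, Matrix.one_mul, trace_one, trace_mul_comm X B]
  ring

lemma D1_eq (B Y X : Matrix ι ι ℝ) : D1 B Y X = (Y * (X * B - B * X)).trace := by
  rw [D1]
  simp only [Matrix.mul_sub, trace_sub]
  rw [trace_mul_comm B (Y * X), Matrix.mul_assoc Y X B, ← Matrix.mul_assoc B X Y,
    trace_mul_comm (B * X) Y]

lemma trace_sq_orth (B X : Matrix ι ι ℝ) (hX : Xᵀ = -X) (hXX : X * X = -1) :
    ((X * B) * (X * B)ᵀ).trace = (B * Bᵀ).trace := by
  rw [transpose_mul, hX, trace_mul_comm]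
  have : Bᵀ * -X * (X * B) = Bᵀ * B := by
    rw [Matrix.mul_assoc, ← Matrix.mul_assoc (-X), Matrix.neg_mul, hXX, neg_neg, Matrix.one_mul]
  rw [this, trace_mul_comm]

lemma trace_sq_orth' (B X : Matrix ι ι ℝ) (hX : Xᵀ = -X) (hXX : X * X = -1) :
    ((B * X) * (B * X)ᵀ).trace = (B * Bᵀ).trace := by
  rw [transpose_mul, hX]
  have : B * X * (-X * Bᵀ) = B * Bᵀ := by
    rw [Matrix.mul_assoc, ← Matrix.mul_assoc X, Matrix.mul_neg, hXX, neg_neg, Matrix.one_mul]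
  rw [this]

/-- the quadratic observable -/
def hh (B X : Matrix ι ι ℝ) : ℝ := (X * B * (X * B)).trace

lemma sum_D1_sq (B X : Matrix ι ι ℝ) (hX : Xᵀ = -X) (hXX : X * X = -1) (hB : Bᵀ = -B) :
    ∑ a, ∑ b, D1 B (Yab a b) X ^ 2 = 8 * (B * Bᵀ).trace - 8 * hh B X := by
  simp only [D1_eq, sum_sq]
  have hW : (X * B - B * X)ᵀ = -(X * B - B * X) := by
    rw [transpose_sub, transpose_mul, transpose_mul, hX, hB]
    simp
  have h1 : ((X * B - B * X) * (X * B - B * X)).trace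
      = - ((X * B - B * X) * (X * B - B * X)ᵀ).trace := by
    rw [hW, Matrix.mul_neg, trace_neg, neg_neg]
  have h2 : ((X * B - B * X) * (X * B - B * X)ᵀ).trace = 2 * (B * Bᵀ).trace - 2 * hh B X := by
    rw [transpose_sub, Matrix.mul_sub, Matrix.sub_mul, Matrix.sub_mul, trace_sub, trace_sub,
      trace_sub, trace_sq_orth B X hX hXX, trace_sq_orth' B X hX hXX]
    have e1 : (B * X)ᵀ = X * B := by rw [transpose_mul, hX, hB]; simp
    have e2 : (X * B)ᵀ = B * X := by rw [transpose_mul, hX, hB]; simp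
    rw [e1, e2, hh]
    have : (B * X * (B * X)).trace = (X * B * (X * B)).trace := by
      rw [Matrix.mul_assoc, trace_mul_comm]; simp only [Matrix.mul_assoc]
    rw [this]; ring
  rw [h1, h2]; ring

lemma BXB_transpose (B X : Matrix ι ι ℝ) (hX : Xᵀ = -X) (hB : Bᵀ = -B) :
    (B * X * B)ᵀ = - (B * X * B) := by
  rw [transpose_mul, transpose_mul, hX, hB]
  simp [Matrix.mul_assoc]

/-- derivative of `2 Tr (Z B X B)` -/
def D2h (B Y X : Matrix ι ι ℝ) : ℝ :=
  2 * D2 (B * X * B) Y X + 2 * ((Y * X - X * Y) * B * ((Y * X - X * Y) * B)).trace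

lemma sum_D2h (B X : Matrix ι ι ℝ) (hX : Xᵀ = -X) (hXX : X * X = -1) (hB : Bᵀ = -B) :
    ∑ a, ∑ b, D2h B (Yab a b) X = -8 * ((Fintype.card ι : ℝ) - 3) * hh B X
      + 8 * (B * Bᵀ).trace - 8 * (B * X).trace ^ 2 := by
  have e : ∀ Y, ((Y * X - X * Y) * B * ((Y * X - X * Y) * B)).trace =
      (Y * (X * B) * Y * (X * B)).trace - (Y * (X * B * X) * Y * B).trace
      - (Y * B * Y * (X * B * X)).trace + (Y * (B * X) * Y * (B * X)).trace := by
    intro Y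
    have h3 : (Y * B * Y * (X * B * X)).trace = (X * Y * B * (Y * X * B)).trace := by
      rw [← Matrix.mul_assoc (Y * B * Y), trace_mul_comm]; simp only [Matrix.mul_assoc]
    have h4 : (Y * (B * X) * Y * (B * X)).trace = (X * Y * B * (X * Y * B)).trace := by
      rw [← Matrix.mul_assoc (Y * (B * X) * Y), trace_mul_comm]; simp only [Matrix.mul_assoc]
    rw [h3, h4]
    simp only [Matrix.mul_sub, Matrix.sub_mul, trace_sub, Matrix.mul_assoc]
    ring
  have tB : B.trace = 0 := by
    have := congrArg trace hB
    rw [trace_transpose, trace_neg] at this; linarith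
  have hC := BXB_transpose B X hX hB
  have hC' := BXB_transpose X B hB hX
  simp only [D2h, e, Finset.sum_add_distrib, Finset.sum_sub_distrib, ← Finset.mul_sum, sum_quad,
    sum_D2 _ X hX hC]
  have k1 : ((X * B)ᵀ * (X * B)).trace = (B * Bᵀ).trace := by
    rw [trace_mul_comm, trace_sq_orth B X hX hXX]
  have k2 : ((B * X)ᵀ * (B * X)).trace = (B * Bᵀ).trace := by
    rw [trace_mul_comm, trace_sq_orth' B X hX hXX]
  have k3 : (B * X * B * X).trace = hh B X := by
    rw [trace_mul_comm, hh]; simp only [Matrix.mul_assoc]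
  have k4 : (X * B * X * B).trace = hh B X := by
    rw [hh]; simp only [Matrix.mul_assoc]
  have k5 : (B * (X * B * X)).trace = hh B X := by
    rw [← k3]; simp only [Matrix.mul_assoc]
  rw [k1, k2, hC', hB, Matrix.neg_mul, Matrix.neg_mul, trace_neg, trace_neg, k3, k4, k5, tB,
    trace_mul_comm X B]
  ring

lemma frob_nonneg (B : Matrix ι ι ℝ) : 0 ≤ (B * Bᵀ).trace := by
  simp only [Matrix.trace, Matrix.mul_apply, diag_apply, transpose_apply]
  exact Finset.sum_nonneg fun a _ => Finset.sum_nonneg fun b _ => mul_self_nonneg _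

lemma frob_cs (P Q : Matrix ι ι ℝ) :
    (P * Q).trace ^ 2 ≤ (P * Pᵀ).trace * (Q * Qᵀ).trace := by
  have h1 : (P * Q).trace = ∑ p : ι × ι, P p.1 p.2 * Q p.2 p.1 := by
    simp [Matrix.trace, Matrix.mul_apply, Fintype.sum_prod_type]
  have h2 : (P * Pᵀ).trace = ∑ p : ι × ι, P p.1 p.2 ^ 2 := by
    simp [Matrix.trace, Matrix.mul_apply, Fintype.sum_prod_type, sq]
  have h3 : (Q * Qᵀ).trace = ∑ p : ι × ι, Q p.2 p.1 ^ 2 := by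
    rw [Fintype.sum_prod_type_right]
    simp [Matrix.trace, Matrix.mul_apply, sq]
  rw [h1, h2, h3]
  exact Finset.sum_mul_sq_le_sq_mul_sq _ _ _

lemma frob_mul (P Q : Matrix ι ι ℝ) :
    ((P * Q) * (P * Q)ᵀ).trace ≤ (P * Pᵀ).trace * (Q * Qᵀ).trace := by
  have h1 : ((P * Q) * (P * Q)ᵀ).trace = ∑ a, ∑ b, (∑ k, P a k * Q k b) ^ 2 := by
    simp [Matrix.trace, Matrix.mul_apply, sq, -transpose_mul]
  have h2 : (P * Pᵀ).trace = ∑ a, ∑ k, P a k ^ 2 := by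
    simp [Matrix.trace, Matrix.mul_apply, sq]
  have h3 : (Q * Qᵀ).trace = ∑ b, ∑ k, Q k b ^ 2 := by
    rw [Finset.sum_comm]
    simp [Matrix.trace, Matrix.mul_apply, sq]
  rw [h1, h2, h3, Finset.sum_mul_sum]
  exact Finset.sum_le_sum fun a _ => Finset.sum_le_sum fun b _ =>
    Finset.sum_mul_sq_le_sq_mul_sq _ _ _

lemma abs_hh_le (B X : Matrix ι ι ℝ) (hX : Xᵀ = -X) (hXX : X * X = -1) :
    |hh B X| ≤ (B * Bᵀ).trace := by
  have := frob_cs (X * B) (X * B)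
  rw [trace_sq_orth B X hX hXX] at this
  exact abs_le_of_sq_le_sq (by rw [hh]; linarith) (frob_nonneg B)

lemma sum_D1h_sq_le (B X : Matrix ι ι ℝ) (hX : Xᵀ = -X) (hXX : X * X = -1) (hB : Bᵀ = -B) :
    ∑ a, ∑ b, (2 * D1 (B * X * B) (Yab a b) X) ^ 2 ≤ 64 * (B * Bᵀ).trace ^ 2 := by
  have hC := BXB_transpose B X hX hB
  have h1 := sum_D1_sq (B * X * B) X hX hXX hC
  have h2 := abs_hh_le (B * X * B) X hX hXX
  have h3 := frob_mul B (X * B)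
  rw [trace_sq_orth B X hX hXX, ← Matrix.mul_assoc] at h3
  have h4 : ∑ a, ∑ b, (2 * D1 (B * X * B) (Yab a b) X) ^ 2
      = 4 * ∑ a, ∑ b, (D1 (B * X * B) (Yab a b) X) ^ 2 := by
    simp only [Finset.mul_sum]
    refine Finset.sum_congr rfl fun a _ => Finset.sum_congr rfl fun b _ => by ring
  rw [h4, h1]
  have := abs_le.mp h2
  nlinarith

end DIII
namespace DIII
section part3
open scoped Matrix.Norms.Operator
variable {ι : Type*} [Fintype ι] [DecidableEq ι]

lemma XX_transpose (K : Matrix ι ι ℝ) (hK : Kᵀ = -K) (g : Matrix.orthogonalGroup ι ℝ) :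
    (XX K g)ᵀ = - XX K g := by
  simp [XX, transpose_mul, hK, Matrix.mul_assoc]

lemma XX_sq (K : Matrix ι ι ℝ) (hK : K * K = -1) (g : Matrix.orthogonalGroup ι ℝ) :
    XX K g * XX K g = -1 := by
  have h1 : (g : Matrix ι ι ℝ)ᵀ * (g : Matrix ι ι ℝ) = 1 :=
    (Matrix.mem_orthogonalGroup_iff' ι ℝ).mp g.2
  have h2 : (g : Matrix ι ι ℝ) * (g : Matrix ι ι ℝ)ᵀ = 1 :=
    (Matrix.mem_orthogonalGroup_iff ι ℝ).mp g.2
  calc XX K g * XX K g = (g : Matrix ι ι ℝ) * K * ((g : Matrix ι ι ℝ)ᵀ * (g : Matrix ι ι ℝ)) * K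
        * (g : Matrix ι ι ℝ)ᵀ := by simp only [XX, Matrix.mul_assoc]
    _ = (g : Matrix ι ι ℝ) * (K * K) * (g : Matrix ι ι ℝ)ᵀ := by
        rw [h1, Matrix.mul_one]; simp only [Matrix.mul_assoc]
    _ = -1 := by rw [hK]; simp [h2]

/-- directional derivative along conjugation -/
def HasY {E : Type*} [NormedAddCommGroup E] [NormedSpace ℝ E] (Y : Matrix ι ι ℝ)
    (F F' : Matrix ι ι ℝ → E) : Prop :=
  ∀ (γ : ℝ → Matrix ι ι ℝ) (θ : ℝ), HasDerivAt γ (Y * γ θ - γ θ * Y) θ →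
      HasDerivAt (fun s => F (γ s)) (F' (γ θ)) θ

lemma hasDerivAt_trace {γ : ℝ → Matrix ι ι ℝ} {γ' : Matrix ι ι ℝ} {θ : ℝ}
    (h : HasDerivAt γ γ' θ) : HasDerivAt (fun s => (γ s).trace) γ'.trace θ :=
  ((Matrix.traceLinearMap ι ℝ ℝ).toContinuousLinearMap.hasFDerivAt).comp_hasDerivAt θ h

lemma hdmul {γ δ : ℝ → Matrix ι ι ℝ} {γ' δ' : Matrix ι ι ℝ} {θ : ℝ}
    (h : HasDerivAt γ γ' θ) (k : HasDerivAt δ δ' θ) :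
    HasDerivAt (fun s => γ s * δ s) (γ' * δ θ + γ θ * δ') θ := HasDerivAt.mul h k

lemma hdcmul {γ : ℝ → Matrix ι ι ℝ} {γ' : Matrix ι ι ℝ} {θ : ℝ} (C : Matrix ι ι ℝ)
    (h : HasDerivAt γ γ' θ) :
    HasDerivAt (fun s => C * γ s) (C * γ') θ := HasDerivAt.const_mul C h

lemma hdmulc {γ : ℝ → Matrix ι ι ℝ} {γ' : Matrix ι ι ℝ} {θ : ℝ} (C : Matrix ι ι ℝ)
    (h : HasDerivAt γ γ' θ) :
    HasDerivAt (fun s => γ s * C) (γ' * C) θ := HasDerivAt.mul_const h C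

lemma hdsub {γ δ : ℝ → Matrix ι ι ℝ} {γ' δ' : Matrix ι ι ℝ} {θ : ℝ}
    (h : HasDerivAt γ γ' θ) (k : HasDerivAt δ δ' θ) :
    HasDerivAt (fun s => γ s - δ s) (γ' - δ') θ := HasDerivAt.sub h k

lemma hasY_f (B Y : Matrix ι ι ℝ) : HasY Y (fun X => (B * X).trace) (D1 B Y) := by
  intro γ θ h
  exact hasDerivAt_trace (hdcmul B h)

lemma hasY_D1 (B Y : Matrix ι ι ℝ) : HasY Y (D1 B Y) (D2 B Y) := by
  intro γ θ h
  exact hasDerivAt_trace (hdcmul B (hdsub (hdcmul Y h) (hdmulc Y h)))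

lemma hasY_h (B Y : Matrix ι ι ℝ) : HasY Y (hh B) (fun X => 2 * D1 (B * X * B) Y X) := by
  intro γ θ h
  refine (hasDerivAt_trace (hdmul (hdmulc B h) (hdmulc B h))).congr_deriv ?_
  change _ = 2 * ((B * γ θ * B) * (Y * γ θ - γ θ * Y)).trace
  rw [trace_add, trace_mul_comm (γ θ * B), ← two_mul,
    trace_mul_comm (B * γ θ * B) (Y * γ θ - γ θ * Y)]
  simp only [Matrix.mul_assoc]

lemma hasY_D1h (B Y : Matrix ι ι ℝ) :
    HasY Y (fun X => 2 * D1 (B * X * B) Y X) (D2h B Y) := by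
  intro γ θ h
  have := (hasDerivAt_trace (hdmul (hdmulc B (hdcmul B h))
    (hdsub (hdcmul Y h) (hdmulc Y h)))).const_mul 2
  refine this.congr_deriv ?_
  rw [trace_add, D2h, D2, mul_add, add_comm]
  congr 2
  rw [trace_mul_comm]
  simp only [Matrix.mul_assoc]

lemma cont_f (B : Matrix ι ι ℝ) : Continuous (fun X : Matrix ι ι ℝ => (B * X).trace) := by
  fun_prop
lemma cont_D1 (B Y : Matrix ι ι ℝ) : Continuous (D1 B Y) := by
  unfold D1; fun_prop
lemma cont_D2 (B Y : Matrix ι ι ℝ) : Continuous (D2 B Y) := by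
  unfold D2; fun_prop
lemma cont_h (B : Matrix ι ι ℝ) : Continuous (hh B) := by
  unfold hh; fun_prop
lemma cont_D1h (B Y : Matrix ι ι ℝ) : Continuous (fun X => 2 * D1 (B * X * B) Y X) := by
  unfold D1; fun_prop
lemma cont_D2h (B Y : Matrix ι ι ℝ) : Continuous (D2h B Y) := by
  unfold D2h D2; fun_prop

lemma integrable_XX {E : Type*} [NormedAddCommGroup E] [SecondCountableTopology E]
    (μ : Measure (Matrix.orthogonalGroup ι ℝ)) [IsProbabilityMeasure μ]
    (K : Matrix ι ι ℝ) {F : Matrix ι ι ℝ → E} (hF : Continuous F) :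
    Integrable (fun g => F (XX K g)) μ := by
  have hcont := hF.comp (continuous_XX K)
  obtain ⟨D, hD⟩ := isCompact_univ.exists_bound_of_continuousOn hcont.continuousOn
  exact Integrable.of_bound hcont.aestronglyMeasurable D (ae_of_all _ fun g => hD g trivial)

/-- summed integration by parts -/
lemma ibp_sum {E : Type*} [NormedAddCommGroup E] [NormedSpace ℝ E] [SecondCountableTopology E]
    (μ : Measure (Matrix.orthogonalGroup ι ℝ)) [IsProbabilityMeasure μ]
    [μ.IsMulLeftInvariant] (K : Matrix ι ι ℝ)
    (P P' : Matrix ι ι ℝ → Matrix ι ι ℝ → ℝ) (G : Matrix ι ι ℝ → E)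
    (G' : Matrix ι ι ℝ → Matrix ι ι ℝ → E)
    (hP : ∀ Y, HasY Y (P Y) (P' Y)) (hG : ∀ Y, HasY Y G (G' Y))
    (cP : ∀ Y, Continuous (P Y)) (cP' : ∀ Y, Continuous (P' Y)) (cG : Continuous G)
    (cG' : ∀ Y, Continuous (G' Y)) :
    ∫ g, (∑ a, ∑ b, (P' (Yab a b) (XX K g) • G (XX K g)
      + P (Yab a b) (XX K g) • G' (Yab a b) (XX K g))) ∂μ = 0 := by
  have hc : ∀ Y, Continuous (fun X => P' Y X • G X + P Y X • G' Y X) := fun Y =>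
    ((cP' Y).smul cG).add ((cP Y).smul (cG' Y))
  have h0 : ∀ a b, ∫ g, (P' (Yab a b) (XX K g) • G (XX K g)
      + P (Yab a b) (XX K g) • G' (Yab a b) (XX K g)) ∂μ = 0 := by
    intro a b
    refine ibp μ K (Yab a b) (Yab_transpose a b) (fun X => P (Yab a b) X • G X)
      (fun X => P' (Yab a b) X • G X + P (Yab a b) X • G' (Yab a b) X)
      ((cP _).smul cG) (hc _) ?_
    intro γ θ h
    have h1 := hP _ γ θ h
    have h2 := hG _ γ θ h
    refine (h1.smul h2).congr_deriv ?_
    rw [add_comm]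
  rw [integral_finsetSum _ fun a _ => integrable_finsetSum _ fun b _ => integrable_XX μ K (hc _)]
  refine Finset.sum_eq_zero fun a _ => ?_
  rw [integral_finsetSum _ fun b _ => integrable_XX μ K (hc _)]
  exact Finset.sum_eq_zero fun b _ => h0 a b

end part3
end DIII
namespace DIII
section part4
variable {ι : Type*} [Fintype ι] [DecidableEq ι]

lemma integral_add3 {Ω E : Type*} [MeasurableSpace Ω] {μ : Measure Ω} [NormedAddCommGroup E]
    [NormedSpace ℝ E] {u v w : Ω → E} (hu : Integrable u μ) (hv : Integrable v μ)
    (hw : Integrable w μ) :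
    ∫ x, (u x + (v x + w x)) ∂μ = ∫ x, u x ∂μ + (∫ x, v x ∂μ + ∫ x, w x ∂μ) := by
  rw [← integral_add hv hw]
  exact integral_add hu (hv.add hw)

lemma stein_alg {N a b c β z : ℂ} (hN : N - 2 ≠ 0)
    (h : -4 * (N - 2) * a + (z * (8 * β) * b + -8 * z * c) = 0) :
    a = z * (2 / (N - 2)) * β * b - z * (2 / (N - 2)) * c := by
  field_simp
  linear_combination (-1/4 : ℂ) * h

lemma integral_f_sq_le (μ : Measure (Matrix.orthogonalGroup ι ℝ)) [IsProbabilityMeasure μ]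
    [μ.IsMulLeftInvariant] (K B : Matrix ι ι ℝ) (hK : Kᵀ = -K) (hKK : K * K = -1)
    (hB : Bᵀ = -B) (hN : 6 ≤ (Fintype.card ι : ℝ)) :
    ∫ g, (B * XX K g).trace ^ 2 ∂μ ≤ (B * Bᵀ).trace := by
  have h := ibp_sum μ K (D1 B) (D2 B) (fun X => (B * X).trace) (D1 B) (hasY_D1 B) (hasY_f B)
    (cont_D1 B) (cont_D2 B) (cont_f B) (cont_D1 B)
  have e : ∀ g, (∑ a, ∑ b, (D2 B (Yab a b) (XX K g) • (B * XX K g).trace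
      + D1 B (Yab a b) (XX K g) • D1 B (Yab a b) (XX K g))) =
      -4 * ((Fintype.card ι : ℝ) - 2) * (B * XX K g).trace ^ 2
        + (8 * (B * Bᵀ).trace - 8 * hh B (XX K g)) := by
    intro g
    have hX := XX_transpose K hK g
    rw [← sum_D1_sq B _ hX (XX_sq K hKK g) hB]
    simp only [smul_eq_mul, Finset.sum_add_distrib, ← Finset.sum_mul, sum_D2 B _ hX hB, ← sq]
    ring
  simp only [e] at h
  have i1 : Integrable (fun g => (B * XX K g).trace ^ 2) μ :=
    integrable_XX μ K (F := fun X => (B * X).trace ^ 2) ((cont_f B).pow 2)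
  have i2 : Integrable (fun g => 8 * (B * Bᵀ).trace - 8 * hh B (XX K g)) μ :=
    integrable_XX μ K (F := fun X => 8 * (B * Bᵀ).trace - 8 * hh B X)
      (continuous_const.sub (continuous_const.mul (cont_h B)))
  rw [integral_add (i1.const_mul _) i2, integral_const_mul] at h
  have h3 : ∫ g, (8 * (B * Bᵀ).trace - 8 * hh B (XX K g)) ∂μ ≤ 16 * (B * Bᵀ).trace := by
    calc _ ≤ ∫ g, 16 * (B * Bᵀ).trace ∂μ := by
          refine integral_mono i2 (integrable_const _) fun g => ?_
          have := abs_le.mp (abs_hh_le B _ (XX_transpose K hK g) (XX_sq K hKK g))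
          simp only
          linarith
      _ = _ := by simp
  have h4 : 0 ≤ ∫ g, (B * XX K g).trace ^ 2 ∂μ := integral_nonneg fun g => sq_nonneg _
  nlinarith

lemma integral_h_sq_le (μ : Measure (Matrix.orthogonalGroup ι ℝ)) [IsProbabilityMeasure μ]
    [μ.IsMulLeftInvariant] (K B : Matrix ι ι ℝ) (hK : Kᵀ = -K) (hKK : K * K = -1)
    (hB : Bᵀ = -B) (hN : 6 ≤ (Fintype.card ι : ℝ)) :
    ((Fintype.card ι : ℝ) - 3) * ∫ g, hh B (XX K g) ^ 2 ∂μ ≤ 10 * (B * Bᵀ).trace ^ 2 := by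
  have h := ibp_sum μ K (fun Y X => 2 * D1 (B * X * B) Y X) (D2h B) (hh B)
    (fun Y X => 2 * D1 (B * X * B) Y X) (hasY_D1h B) (hasY_h B)
    (cont_D1h B) (cont_D2h B) (cont_h B) (cont_D1h B)
  have e : ∀ g, -(∑ a, ∑ b, (D2h B (Yab a b) (XX K g) • hh B (XX K g)
      + (2 * D1 (B * XX K g * B) (Yab a b) (XX K g)) •
        (2 * D1 (B * XX K g * B) (Yab a b) (XX K g)))) ≥
      8 * ((Fintype.card ι : ℝ) - 3) * hh B (XX K g) ^ 2
        + (-72 * (B * Bᵀ).trace ^ 2 + (-8 * (B * Bᵀ).trace) * (B * XX K g).trace ^ 2) := by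
    intro g
    have hX := XX_transpose K hK g
    have hXX := XX_sq K hKK g
    have h1 := sum_D1h_sq_le B _ hX hXX hB
    have h2 := abs_le.mp (abs_hh_le B _ hX hXX)
    simp only [smul_eq_mul, Finset.sum_add_distrib, ← Finset.sum_mul, sum_D2h B _ hX hXX hB, ← sq]
    have h3 := frob_nonneg B
    nlinarith [mul_nonneg (sub_nonneg.mpr h2.2) h3, sq_nonneg (B * XX K g).trace,
      mul_nonneg (sq_nonneg (B * XX K g).trace) (by linarith : 0 ≤ hh B (XX K g) + (B * Bᵀ).trace)]
  have i1 : Integrable (fun g => (B * XX K g).trace ^ 2) μ :=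
    integrable_XX μ K (F := fun X => (B * X).trace ^ 2) ((cont_f B).pow 2)
  have i2 : Integrable (fun g => hh B (XX K g) ^ 2) μ :=
    integrable_XX μ K (F := fun X => hh B X ^ 2) ((cont_h B).pow 2)
  have i3 : Integrable (fun g => -(∑ a, ∑ b, (D2h B (Yab a b) (XX K g) • hh B (XX K g)
      + (2 * D1 (B * XX K g * B) (Yab a b) (XX K g)) •
        (2 * D1 (B * XX K g * B) (Yab a b) (XX K g))))) μ :=
    integrable_XX μ K (F := fun X => -(∑ a, ∑ b, (D2h B (Yab a b) X • hh B X
      + (2 * D1 (B * X * B) (Yab a b) X) •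
        (2 * D1 (B * X * B) (Yab a b) X))))
      (Continuous.neg (continuous_finsetSum _ fun a _ => continuous_finsetSum _ fun b _ =>
        ((cont_D2h B _).smul (cont_h B)).add ((cont_D1h B _).smul (cont_D1h B _))))
  have h5 := integral_mono ((i2.const_mul (8 * ((Fintype.card ι : ℝ) - 3))).add
    ((integrable_const (-72 * (B * Bᵀ).trace ^ 2)).add (i1.const_mul (-8 * (B * Bᵀ).trace)))) i3 e
  rw [integral_neg, h, neg_zero] at h5
  simp only [Pi.add_apply] at h5
  rw [integral_add3 (i2.const_mul _) (integrable_const _) (i1.const_mul _)] at h5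
  simp only [integral_const, probReal_univ, one_smul] at h5
  rw [integral_const_mul, integral_const_mul] at h5
  have h6 := integral_f_sq_le μ K B hK hKK hB hN
  have h7 := frob_nonneg B
  nlinarith [mul_le_mul_of_nonneg_left h6 h7]

lemma integral_abs_h_le (μ : Measure (Matrix.orthogonalGroup ι ℝ)) [IsProbabilityMeasure μ]
    [μ.IsMulLeftInvariant] (K B : Matrix ι ι ℝ) (hK : Kᵀ = -K) (hKK : K * K = -1)
    (hB : Bᵀ = -B) (hN : 6 ≤ (Fintype.card ι : ℝ)) :
    ((Fintype.card ι : ℝ) - 3) * (∫ g, |hh B (XX K g)| ∂μ) ^ 2 ≤ 10 * (B * Bᵀ).trace ^ 2 := by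
  refine le_trans ?_ (integral_h_sq_le μ K B hK hKK hB hN)
  refine mul_le_mul_of_nonneg_left ?_ (by linarith)
  set m := ∫ g, |hh B (XX K g)| ∂μ with hm
  have i1 : Integrable (fun g => |hh B (XX K g)|) μ :=
    integrable_XX μ K (F := fun X => |hh B X|) ((cont_h B).abs)
  have i2 : Integrable (fun g => hh B (XX K g) ^ 2) μ :=
    integrable_XX μ K (F := fun X => hh B X ^ 2) ((cont_h B).pow 2)
  have : 0 ≤ ∫ g, (hh B (XX K g) ^ 2 + ((-2 * m) * |hh B (XX K g)| + m ^ 2)) ∂μ := by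
    refine integral_nonneg fun g => ?_
    have := sq_nonneg (|hh B (XX K g)| - m)
    have h2 := sq_abs (hh B (XX K g))
    simp only [Pi.zero_apply]
    nlinarith
  rw [integral_add3 i2 (i1.const_mul _) (integrable_const _), integral_const_mul, ← hm] at this
  simp only [integral_const, probReal_univ, one_smul] at this
  linarith

open Complex in
lemma stein (μ : Measure (Matrix.orthogonalGroup ι ℝ)) [IsProbabilityMeasure μ]
    [μ.IsMulLeftInvariant] (K B : Matrix ι ι ℝ) (hK : Kᵀ = -K) (hKK : K * K = -1)
    (hB : Bᵀ = -B) (hN : 6 ≤ (Fintype.card ι : ℝ)) (t : ℝ) :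
    ∫ g, (((B * XX K g).trace : ℝ) : ℂ) * cexp (I * t * ((B * XX K g).trace : ℝ)) ∂μ =
      I * t * (2 / ((Fintype.card ι : ℂ) - 2)) * ((B * Bᵀ).trace : ℝ) *
        (∫ g, cexp (I * t * ((B * XX K g).trace : ℝ)) ∂μ)
      - I * t * (2 / ((Fintype.card ι : ℂ) - 2)) *
        ∫ g, ((hh B (XX K g) : ℝ) : ℂ) * cexp (I * t * ((B * XX K g).trace : ℝ)) ∂μ := by
  have cE : Continuous (fun X : Matrix ι ι ℝ => cexp (I * t * ((B * X).trace : ℝ))) :=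
    continuous_exp.comp (continuous_const.mul (continuous_ofReal.comp (cont_f B)))
  have h := ibp_sum μ K (D1 B) (D2 B) (fun X => cexp (I * t * ((B * X).trace : ℝ)))
    (fun Y X => cexp (I * t * ((B * X).trace : ℝ)) * (I * t * (D1 B Y X : ℝ)))
    (hasY_D1 B) (by
      intro Y γ θ h
      exact (((hasY_f B Y γ θ h).ofReal_comp).const_mul (I * t)).cexp)
    (cont_D1 B) (cont_D2 B) cE
    (fun Y => cE.mul (continuous_const.mul (continuous_ofReal.comp (cont_D1 B Y))))
  have e : ∀ g, (∑ a, ∑ b, (D2 B (Yab a b) (XX K g) • cexp (I * t * ((B * XX K g).trace : ℝ))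
      + D1 B (Yab a b) (XX K g) • (cexp (I * t * ((B * XX K g).trace : ℝ)) *
        (I * t * (D1 B (Yab a b) (XX K g) : ℝ))))) =
      -4 * ((Fintype.card ι : ℂ) - 2) * ((((B * XX K g).trace : ℝ) : ℂ) *
          cexp (I * t * ((B * XX K g).trace : ℝ)))
        + (I * t * (8 * ((B * Bᵀ).trace : ℝ)) * cexp (I * t * ((B * XX K g).trace : ℝ))
        + (-8 * I * t) * (((hh B (XX K g) : ℝ) : ℂ) *
          cexp (I * t * ((B * XX K g).trace : ℝ)))) := by
    intro g
    have hX := XX_transpose K hK g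
    have s1 := congrArg (fun x : ℝ => (x : ℂ)) (sum_D1_sq B _ hX (XX_sq K hKK g) hB)
    have s2 := congrArg (fun x : ℝ => (x : ℂ)) (sum_D2 B _ hX hB)
    simp only [ofReal_sum, ofReal_mul, ofReal_sub, ofReal_pow, ofReal_natCast, ofReal_neg,
      ofReal_ofNat] at s1 s2
    have s3 : ∀ a b, D1 B (Yab a b) (XX K g) • (cexp (I * t * ((B * XX K g).trace : ℝ)) *
        (I * t * (D1 B (Yab a b) (XX K g) : ℝ))) = ((D1 B (Yab a b) (XX K g) : ℝ) : ℂ) ^ 2 *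
        (I * t * cexp (I * t * ((B * XX K g).trace : ℝ))) := by
      intro a b
      rw [real_smul]; ring
    simp only [s3, real_smul, Finset.sum_add_distrib, ← Finset.sum_mul]
    rw [s1, s2]
    ring
  simp only [e] at h
  have i1 : Integrable (fun g => (((B * XX K g).trace : ℝ) : ℂ) *
      cexp (I * t * ((B * XX K g).trace : ℝ))) μ :=
    integrable_XX μ K (F := fun X => (((B * X).trace : ℝ) : ℂ) *
      cexp (I * t * ((B * X).trace : ℝ))) ((continuous_ofReal.comp (cont_f B)).mul cE)
  have i2 : Integrable (fun g => cexp (I * t * ((B * XX K g).trace : ℝ))) μ :=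
    integrable_XX μ K cE
  have i3 : Integrable (fun g => ((hh B (XX K g) : ℝ) : ℂ) *
      cexp (I * t * ((B * XX K g).trace : ℝ))) μ :=
    integrable_XX μ K (F := fun X => ((hh B X : ℝ) : ℂ) *
      cexp (I * t * ((B * X).trace : ℝ))) ((continuous_ofReal.comp (cont_h B)).mul cE)
  rw [integral_add3 (i1.const_mul _) (i2.const_mul _) (i3.const_mul _), integral_const_mul, integral_const_mul,
    integral_const_mul] at h
  have hne : (Fintype.card ι : ℂ) - 2 ≠ 0 := by
    intro h0
    have := congrArg re h0
    simp at this
    linarith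
  exact stein_alg hne (by linear_combination h)

end part4
end DIII
namespace DIII
section part5
variable {ι : Type*} [Fintype ι] [DecidableEq ι]

open Complex in
lemma charfun_bound (μ : Measure (Matrix.orthogonalGroup ι ℝ)) [IsProbabilityMeasure μ]
    [μ.IsMulLeftInvariant] (K B : Matrix ι ι ℝ) (hK : Kᵀ = -K) (hKK : K * K = -1)
    (hB : Bᵀ = -B) (hN : 6 ≤ (Fintype.card ι : ℝ)) (s : ℝ)
    (hs : s = 2 / ((Fintype.card ι : ℝ) - 2) * (B * Bᵀ).trace) :
    ‖∫ g, cexp (I * ((B * XX K g).trace : ℝ)) ∂μ - cexp (-(s / 2 : ℝ))‖ ≤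
      2 / ((Fintype.card ι : ℝ) - 2) * ∫ g, |hh B (XX K g)| ∂μ := by
  set m := ∫ g, |hh B (XX K g)| ∂μ with hm
  set q : ℝ := 2 / ((Fintype.card ι : ℝ) - 2) with hq
  have hq0 : 0 ≤ q := div_nonneg (by norm_num) (by linarith)
  have hs0 : 0 ≤ s := by rw [hs]; exact mul_nonneg hq0 (frob_nonneg B)
  have hm0 : 0 ≤ m := integral_nonneg fun g => abs_nonneg _
  have hqc : (2 / ((Fintype.card ι : ℂ) - 2)) = (q : ℂ) := by
    rw [hq]; push_cast; rfl
  let φ : ℝ → ℂ := fun t => ∫ g, cexp (I * t * ((B * XX K g).trace : ℝ)) ∂μ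
  have cE : ∀ t : ℝ, Continuous (fun X : Matrix ι ι ℝ => cexp (I * t * ((B * X).trace : ℝ))) :=
    fun t => continuous_exp.comp (continuous_const.mul (continuous_ofReal.comp (cont_f B)))
  have nE : ∀ (t x : ℝ), ‖cexp (I * t * x)‖ = 1 := by
    intro t x
    rw [show I * (t : ℂ) * x = ((t * x : ℝ) : ℂ) * I by push_cast; ring]
    exact norm_exp_ofReal_mul_I _
  have i1 : ∀ t : ℝ, Integrable (fun g => cexp (I * t * ((B * XX K g).trace : ℝ))) μ :=
    fun t => integrable_XX μ K (cE t)
  have hφ : ∀ t : ℝ, HasDerivAt φ (I * ∫ g, (((B * XX K g).trace : ℝ) : ℂ) *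
      cexp (I * t * ((B * XX K g).trace : ℝ)) ∂μ) t := by
    intro t
    have key := hasDerivAt_integral_of_dominated_loc_of_deriv_le (μ := μ) (s := Set.univ)
      (F := fun (t : ℝ) g => cexp (I * t * ((B * XX K g).trace : ℝ)))
      (F' := fun (t : ℝ) g => I * ((((B * XX K g).trace : ℝ) : ℂ) *
        cexp (I * t * ((B * XX K g).trace : ℝ))))
      (x₀ := t) (bound := fun g => |(B * XX K g).trace|) univ_mem
      (Eventually.of_forall fun t => (i1 t).aestronglyMeasurable) (i1 t)
      (integrable_XX μ K (F := fun X => I * ((((B * X).trace : ℝ) : ℂ) *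
        cexp (I * t * ((B * X).trace : ℝ)))) (continuous_const.mul
          ((continuous_ofReal.comp (cont_f B)).mul (cE t)))).aestronglyMeasurable
      (ae_of_all _ fun g t _ => by
        rw [norm_mul, norm_mul, nE, norm_I, norm_real, Real.norm_eq_abs]; simp)
      (integrable_XX μ K (F := fun X => |(B * X).trace|) (cont_f B).abs)
      (ae_of_all _ fun g t _ => by
        have h1 : HasDerivAt (fun t : ℝ => I * (t : ℂ) * ((B * XX K g).trace : ℝ))
            (I * ((B * XX K g).trace : ℝ)) t := by
          have := (((hasDerivAt_id t).ofReal_comp).const_mul I).mul_const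
            (((B * XX K g).trace : ℝ) : ℂ)
          simpa using this
        refine h1.cexp.congr_deriv ?_
        ring)
    have h2 := key.2
    rw [integral_const_mul] at h2
    exact h2
  let E : ℝ → ℂ := fun t => ((Real.exp (s * t ^ 2 / 2) : ℝ) : ℂ)
  have hE : ∀ t, HasDerivAt E (((Real.exp (s * t ^ 2 / 2) * (s * t) : ℝ)) : ℂ) t := by
    intro t
    have h1 : HasDerivAt (fun t : ℝ => s * t ^ 2 / 2) (s * t) t := by
      have := (((hasDerivAt_id t).pow 2).const_mul s).div_const 2
      refine this.congr_deriv ?_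
      simp; ring
    exact h1.exp.ofReal_comp
  let c : ℝ → ℂ := fun t => ∫ g, ((hh B (XX K g) : ℝ) : ℂ) *
    cexp (I * t * ((B * XX K g).trace : ℝ)) ∂μ
  have hc : ∀ t, ‖c t‖ ≤ m := by
    intro t
    refine (norm_integral_le_integral_norm _).trans (le_of_eq ?_)
    refine integral_congr_ae (ae_of_all _ fun g => ?_)
    simp only [norm_mul, nE, norm_real, Real.norm_eq_abs, mul_one]
  have hψ : ∀ t : ℝ, HasDerivAt (fun t => φ t * E t) (E t * t * q * c t) t := by
    intro t
    refine ((hφ t).mul (hE t)).congr_deriv ?_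
    rw [stein μ K B hK hKK hB hN t, hqc]
    change I * (I * t * q * ((B * Bᵀ).trace : ℝ) * φ t - I * t * q * c t) * E t +
      φ t * ((Real.exp (s * t ^ 2 / 2) * (s * t) : ℝ) : ℂ) = _
    have : ((Real.exp (s * t ^ 2 / 2) * (s * t) : ℝ) : ℂ)
        = E t * (q * ((B * Bᵀ).trace : ℝ) * t) := by
      rw [hs]; simp only [E, ofReal_mul, hs]
    rw [this]
    linear_combination (t * q * ((B * Bᵀ).trace : ℝ) * φ t * E t - t * q * c t * E t) * I_sq
  have hbd : ∀ t ∈ Set.Ico (0:ℝ) 1, ‖E t * t * q * c t‖ ≤ Real.exp (s / 2) * (q * m) := by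
    intro t ht
    have e1 : ‖E t‖ ≤ Real.exp (s / 2) := by
      simp only [E, norm_real, Real.norm_eq_abs, Real.abs_exp]
      apply Real.exp_le_exp.mpr
      have : t ^ 2 ≤ 1 := by nlinarith [ht.1, ht.2]
      nlinarith
    have e2 : ‖(t : ℂ)‖ ≤ 1 := by
      rw [norm_real, Real.norm_eq_abs, abs_le]; constructor <;> linarith [ht.1, ht.2]
    have e3 : ‖(q : ℂ)‖ = q := by rw [norm_real, Real.norm_eq_abs, abs_of_nonneg hq0]
    rw [norm_mul, norm_mul, norm_mul, e3]
    calc ‖E t‖ * ‖(t : ℂ)‖ * q * ‖c t‖ ≤ Real.exp (s / 2) * 1 * q * m := by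
          gcongr
          exact hc t
      _ = _ := by ring
  have hmv := norm_image_sub_le_of_norm_deriv_le_segment'
    (fun t _ => (hψ t).hasDerivWithinAt) hbd 1 (by simp)
  have φ0 : φ 0 = 1 := by simp [φ]
  have E0 : E 0 = 1 := by simp [E]
  have φ1 : φ 1 = ∫ g, cexp (I * ((B * XX K g).trace : ℝ)) ∂μ := by simp [φ]
  have E1 : E 1 = ((Real.exp (s / 2) : ℝ) : ℂ) := by simp [E]
  simp only [φ0, E0, E1, φ1] at hmv
  have hfac : ∫ g, cexp (I * ((B * XX K g).trace : ℝ)) ∂μ - cexp (-(s / 2 : ℝ)) =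
      ((Real.exp (-(s / 2)) : ℝ) : ℂ) * ((∫ g, cexp (I * ((B * XX K g).trace : ℝ)) ∂μ) *
        ((Real.exp (s / 2) : ℝ) : ℂ) - 1 * 1) := by
    have : ((Real.exp (-(s / 2)) : ℝ) : ℂ) * ((Real.exp (s / 2) : ℝ) : ℂ) = 1 := by
      rw [← ofReal_mul, ← Real.exp_add]; simp
    have h2 : cexp (-(s / 2 : ℝ)) = ((Real.exp (-(s / 2)) : ℝ) : ℂ) := by push_cast; rfl
    rw [h2]
    linear_combination (-∫ g, cexp (I * ((B * XX K g).trace : ℝ)) ∂μ) * this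
  rw [hfac, norm_mul, norm_real, Real.norm_eq_abs, Real.abs_exp]
  calc _ ≤ Real.exp (-(s / 2)) * (Real.exp (s / 2) * (q * m) * (1 - 0)) := by gcongr
    _ = (Real.exp (-(s / 2)) * Real.exp (s / 2)) * (q * m) := by ring
    _ = q * m := by rw [← Real.exp_add]; simp

end part5
end DIII
namespace DIII

lemma Jmat_transpose (n : ℕ) : (Jmat n)ᵀ = - Jmat n := by
  simp [Jmat, Matrix.fromBlocks_transpose, Matrix.fromBlocks_neg]

lemma Jmat_sq (n : ℕ) : Jmat n * Jmat n = -1 := by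
  rw [Jmat, Matrix.fromBlocks_multiply, ← Matrix.fromBlocks_one, Matrix.fromBlocks_neg]
  simp

lemma skew_JA {n : ℕ} (A : Matrix (Fin n ⊕ Fin n) (Fin n ⊕ Fin n) ℝ)
    (hA : (A * Jmat n)ᵀ = -(A * Jmat n)) : (Jmat n * A)ᵀ = -(Jmat n * A) := by
  have h1 : Jmat n * Aᵀ = A * Jmat n := by
    rw [transpose_mul, Jmat_transpose, Matrix.neg_mul] at hA
    exact neg_injective hA
  have h2 : Jmat n * (Jmat n * Aᵀ) * Jmat n = Jmat n * (A * Jmat n) * Jmat n := by rw [h1]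
  have h3 : Jmat n * (Jmat n * Aᵀ) * Jmat n = -(Aᵀ * Jmat n) := by
    rw [← Matrix.mul_assoc, Jmat_sq]; simp
  have h4 : Jmat n * (A * Jmat n) * Jmat n = -(Jmat n * A) := by
    rw [Matrix.mul_assoc, Matrix.mul_assoc, Jmat_sq]; simp
  rw [transpose_mul, Jmat_transpose, Matrix.mul_neg, ← h3, h2, h4]

lemma frob_JA {n : ℕ} (A : Matrix (Fin n ⊕ Fin n) (Fin n ⊕ Fin n) ℝ) :
    ((Jmat n * A) * (Jmat n * A)ᵀ).trace = (A * Aᵀ).trace :=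
  trace_sq_orth A (Jmat n) (Jmat_transpose n) (Jmat_sq n)

lemma trace_AV {n : ℕ} (A : Matrix (Fin n ⊕ Fin n) (Fin n ⊕ Fin n) ℝ)
    (g : Matrix.orthogonalGroup (Fin n ⊕ Fin n) ℝ) :
    (A * ((g : Matrix (Fin n ⊕ Fin n) (Fin n ⊕ Fin n) ℝ) * (Jmat n)ᵀ
      * (g : Matrix (Fin n ⊕ Fin n) (Fin n ⊕ Fin n) ℝ)ᵀ * Jmat n)).trace =
      ((Jmat n * A) * XX (Jmat n)ᵀ g).trace := by
  rw [XX, ← Matrix.mul_assoc, trace_mul_comm, ← Matrix.mul_assoc]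

open Complex in
lemma clt (C : (n : ℕ) → Matrix (Fin n ⊕ Fin n) (Fin n ⊕ Fin n) ℝ)
    (hC : ∀ n, (C n * Jmat n)ᵀ = -(C n * Jmat n)) (σ : ℝ)
    (hσ : Tendsto (fun n : ℕ => (1 / (n : ℝ)) * ((C n * (C n)ᵀ).trace)) atTop (𝓝 σ))
    (μ : (n : ℕ) → Measure (Matrix.orthogonalGroup (Fin n ⊕ Fin n) ℝ))
    (hprob : ∀ n, IsProbabilityMeasure (μ n))
    (hinv : ∀ n, (μ n).IsMulLeftInvariant) :
    Tendsto (fun n : ℕ => ∫ g, cexp (I * (((Jmat n * C n) * XX (Jmat n)ᵀ g).trace : ℝ)) ∂ μ n)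
      atTop (𝓝 (cexp (-(σ / 2 : ℝ)))) := by
  let s : ℕ → ℝ := fun n => 2 / ((Fintype.card (Fin n ⊕ Fin n) : ℝ) - 2) *
    ((Jmat n * C n) * (Jmat n * C n)ᵀ).trace
  have hs : Tendsto s atTop (𝓝 σ) := by
    have h1 : Tendsto (fun n : ℕ => (n : ℝ) / ((n : ℝ) + (-1))) atTop (𝓝 1) :=
      tendsto_natCast_div_add_atTop (-1 : ℝ)
    have h2 := h1.mul hσ
    rw [one_mul] at h2
    refine h2.congr' ?_
    filter_upwards [eventually_ge_atTop 2] with n hn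
    have hn' : (2 : ℝ) ≤ n := by exact_mod_cast hn
    simp only [s, frob_JA, Fintype.card_sum, Fintype.card_fin]
    push_cast
    have a1 : (n : ℝ) + -1 ≠ 0 := by linarith
    have a3 : (n : ℝ) ≠ 0 := by linarith
    rw [show (n : ℝ) + n - 2 = 2 * ((n : ℝ) + -1) by ring]
    field_simp
  have hbound : ∀ᶠ n in atTop,
      ‖∫ g, cexp (I * (((Jmat n * C n) * XX (Jmat n)ᵀ g).trace : ℝ)) ∂ μ n
        - cexp (-(s n / 2 : ℝ))‖ ≤ Real.sqrt (10 * s n ^ 2 * (1 / (n : ℝ))) := by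
    filter_upwards [eventually_ge_atTop 3] with n hn
    have hn' : (3 : ℝ) ≤ n := by exact_mod_cast hn
    have := hprob n
    have := hinv n
    have hN : 6 ≤ (Fintype.card (Fin n ⊕ Fin n) : ℝ) := by
      simp only [Fintype.card_sum, Fintype.card_fin]; push_cast; linarith
    have hK : ((Jmat n)ᵀ)ᵀ = -(Jmat n)ᵀ := by rw [Jmat_transpose, transpose_neg, Jmat_transpose]
    have hKK : (Jmat n)ᵀ * (Jmat n)ᵀ = -1 := by rw [Jmat_transpose]; simp [Jmat_sq]
    refine (charfun_bound (μ n) (Jmat n)ᵀ (Jmat n * C n) hK hKK (skew_JA _ (hC n)) hN (s n)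
      rfl).trans ?_
    have h2 := integral_abs_h_le (μ n) (Jmat n)ᵀ (Jmat n * C n) hK hKK (skew_JA _ (hC n)) hN
    apply Real.le_sqrt_of_sq_le
    set m := ∫ g, |hh (Jmat n * C n) (XX (Jmat n)ᵀ g)| ∂μ n
    have hcard : (Fintype.card (Fin n ⊕ Fin n) : ℝ) = n + n := by simp
    simp only [s]
    rw [hcard] at h2 ⊢
    set q := 2 / ((n : ℝ) + n - 2)
    set β := ((Jmat n * C n) * (Jmat n * C n)ᵀ).trace
    have h3 : (n : ℝ) * m ^ 2 ≤ 10 * β ^ 2 := by nlinarith [sq_nonneg m]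
    have h4 : m ^ 2 ≤ 10 * β ^ 2 * (1 / (n : ℝ)) := by
      rw [mul_one_div, le_div_iff₀ (by linarith)]; linarith
    calc (q * m) ^ 2 = q ^ 2 * m ^ 2 := by ring
      _ ≤ q ^ 2 * (10 * β ^ 2 * (1 / (n : ℝ))) := by gcongr
      _ = _ := by ring
  have hz : Tendsto (fun n : ℕ => Real.sqrt (10 * s n ^ 2 * (1 / (n : ℝ)))) atTop (𝓝 0) := by
    have h1 : Tendsto (fun n : ℕ => 10 * s n ^ 2 * (1 / (n : ℝ))) atTop (𝓝 (10 * σ ^ 2 * 0)) :=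
      ((hs.pow 2).const_mul 10).mul tendsto_one_div_atTop_nhds_zero_nat
    rw [mul_zero] at h1
    have h2 := (Real.continuous_sqrt.tendsto 0).comp h1
    rw [Real.sqrt_zero] at h2
    exact h2
  have h0 := squeeze_zero_norm' hbound hz
  have h1 : Tendsto (fun n => cexp (-(s n / 2 : ℝ))) atTop (𝓝 (cexp (-(σ / 2 : ℝ)))) := by
    have : Continuous (fun x : ℝ => cexp (-(x / 2 : ℝ))) := by fun_prop
    exact (this.tendsto σ).comp hs
  have := h0.add h1
  simpa using this

/-- the combined matrix -/
def comb {r : ℕ} (A : Fin r → (n : ℕ) → Matrix (Fin n ⊕ Fin n) (Fin n ⊕ Fin n) ℝ)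
    (t : Fin r → ℝ) (n : ℕ) : Matrix (Fin n ⊕ Fin n) (Fin n ⊕ Fin n) ℝ := ∑ i, t i • A i n

lemma comb_skew {r : ℕ} (A : Fin r → (n : ℕ) → Matrix (Fin n ⊕ Fin n) (Fin n ⊕ Fin n) ℝ)
    (hA : ∀ ν n, (A ν n * Jmat n)ᵀ = -(A ν n * Jmat n)) (t : Fin r → ℝ) (n : ℕ) :
    (comb A t n * Jmat n)ᵀ = -(comb A t n * Jmat n) := by
  simp only [comb, Finset.sum_mul, Matrix.smul_mul, transpose_sum, transpose_smul, hA, smul_neg,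
    Finset.sum_neg_distrib]

lemma comb_trace {r : ℕ} (A : Fin r → (n : ℕ) → Matrix (Fin n ⊕ Fin n) (Fin n ⊕ Fin n) ℝ)
    (t : Fin r → ℝ) (n : ℕ) :
    (comb A t n * (comb A t n)ᵀ).trace =
      ∑ i, ∑ j, t i * (A i n * (A j n)ᵀ).trace * t j := by
  simp only [comb, transpose_sum, transpose_smul, Finset.sum_mul, Finset.mul_sum, trace_sum,
    Matrix.smul_mul, Matrix.mul_smul, trace_smul, smul_eq_mul]
  rw [Finset.sum_comm]
  refine Finset.sum_congr rfl fun i _ => Finset.sum_congr rfl fun j _ => by ring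

lemma comb_tendsto {r : ℕ} (A : Fin r → (n : ℕ) → Matrix (Fin n ⊕ Fin n) (Fin n ⊕ Fin n) ℝ)
    (c : Matrix (Fin r) (Fin r) ℝ)
    (hc : ∀ μ' ν, Tendsto
      (fun n : ℕ => (1 / (n : ℝ)) * ((A μ' n * (A ν n)ᵀ).trace))
      atTop (𝓝 (c μ' ν))) (t : Fin r → ℝ) :
    Tendsto (fun n : ℕ => (1 / (n : ℝ)) * ((comb A t n * (comb A t n)ᵀ).trace)) atTop
      (𝓝 (∑ i, ∑ j, t i * c i j * t j)) := by
  have : Tendsto (fun n : ℕ => ∑ i, ∑ j, t i * ((1 / (n : ℝ)) * ((A i n * (A j n)ᵀ).trace)) * t j)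
      atTop (𝓝 (∑ i, ∑ j, t i * c i j * t j)) :=
    tendsto_finsetSum _ fun i _ => tendsto_finsetSum _ fun j _ =>
      ((hc i j).const_mul _).mul_const _
  refine this.congr fun n => ?_
  rw [comb_trace, Finset.mul_sum]
  refine Finset.sum_congr rfl fun i _ => ?_
  rw [Finset.mul_sum]
  refine Finset.sum_congr rfl fun j _ => by ring

lemma quad_form {r : ℕ} (c : Matrix (Fin r) (Fin r) ℝ) (t : Fin r → ℝ) :
    t ⬝ᵥ c *ᵥ t = ∑ i, ∑ j, t i * c i j * t j := by
  simp only [dotProduct, mulVec, Finset.mul_sum, mul_assoc]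

lemma c_posSemidef {r : ℕ} (A : Fin r → (n : ℕ) → Matrix (Fin n ⊕ Fin n) (Fin n ⊕ Fin n) ℝ)
    (c : Matrix (Fin r) (Fin r) ℝ)
    (hc : ∀ μ' ν, Tendsto
      (fun n : ℕ => (1 / (n : ℝ)) * ((A μ' n * (A ν n)ᵀ).trace))
      atTop (𝓝 (c μ' ν))) : c.PosSemidef := by
  refine Matrix.PosSemidef.of_dotProduct_mulVec_nonneg ?_ ?_
  · ext i j
    simp only [conjTranspose_apply, star_trivial]
    refine tendsto_nhds_unique (hc j i) ((hc i j).congr fun n => ?_)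
    rw [← trace_transpose, transpose_mul, transpose_transpose]
  · intro t
    rw [star_trivial, quad_form]
    refine ge_of_tendsto' (comb_tendsto A c hc t) fun n => ?_
    exact mul_nonneg (by positivity) (frob_nonneg _)

open Complex in
lemma gaussian_isGaussianMeasure {r : ℕ} (c : Matrix (Fin r) (Fin r) ℝ) (hc : c.PosSemidef) :
    IsGaussianMeasure ((multivariateGaussian (0 : EuclideanSpace ℝ (Fin r)) c).map
      (fun x => (WithLp.ofLp x : Fin r → ℝ))) 0 c := by
  have hm : Measurable (fun x : EuclideanSpace ℝ (Fin r) => (WithLp.ofLp x : Fin r → ℝ)) := by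
    fun_prop
  refine ⟨Measure.isProbabilityMeasure_map hm.aemeasurable, fun t => ?_⟩
  have hm2 : Measurable (fun x : Fin r → ℝ => ∑ i, t i * x i) := by fun_prop
  rw [Measure.map_map hm2 hm]
  have : IsProbabilityMeasure ((multivariateGaussian (0 : EuclideanSpace ℝ (Fin r)) c).map
      ((fun x : Fin r → ℝ => ∑ i, t i * x i) ∘ fun x => (WithLp.ofLp x : Fin r → ℝ))) :=
    Measure.isProbabilityMeasure_map (hm2.comp hm).aemeasurable
  apply Measure.ext_of_charFun
  funext u
  rw [charFun_gaussianReal, charFun_apply_real, integral_map (hm2.comp hm).aemeasurable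
    (by fun_prop)]
  have h1 := charFun_multivariateGaussian (μ := (0 : EuclideanSpace ℝ (Fin r))) hc
    (WithLp.toLp 2 (u • t))
  rw [charFun_apply] at h1
  have h0 : 0 ≤ ∑ i, ∑ j, t i * c i j * t j := by
    rw [← quad_form]; exact hc.dotProduct_mulVec_nonneg t
  have h2 : (u • t) ⬝ᵥ c *ᵥ (u • t) = u ^ 2 * ∑ i, ∑ j, t i * c i j * t j := by
    rw [← quad_form, smul_dotProduct, mulVec_smul, dotProduct_smul, smul_eq_mul, smul_eq_mul]; ring
  convert h1 using 1
  · refine integral_congr_ae (ae_of_all _ fun x => ?_)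
    simp only [Function.comp, PiLp.inner_apply]
    congr 2
    rw [← ofReal_mul]
    congr 1
    rw [Finset.mul_sum]
    refine Finset.sum_congr rfl fun i _ => ?_
    simp
    ring
  · congr 1
    simp only [h2, Real.coe_toNNReal _ h0]
    simp
    ring

end DIII

/-- Borel theorem for the class DIII symmetric space `O(2n)/U(n)`:
with `V = g Jᵀ gᵀ J` for `g` Haar distributed on `O(2n)` and real parameter
matrices `A^{(ν,n)}` satisfying `(A J)ᵀ = -(A J)`, the vector `(Tr(A^{(ν,n)} V))_ν`
converges in distribution to the centered Gaussian with covariances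
`c μ ν = lim (1/n) Tr(A^{(μ,n)} (A^{(ν,n)})ᵀ)`. -/
theorem borel_theorem_DIII
    (r : ℕ) (hr : 1 ≤ r)
    (A : Fin r → (n : ℕ) → Matrix (Fin n ⊕ Fin n) (Fin n ⊕ Fin n) ℝ)
    (hA : ∀ ν n, (A ν n * Jmat n)ᵀ = -(A ν n * Jmat n))
    (c : Matrix (Fin r) (Fin r) ℝ)
    (hc : ∀ μ' ν, Tendsto
      (fun n : ℕ => (1 / (n : ℝ)) * ((A μ' n * (A ν n)ᵀ).trace))
      atTop (𝓝 (c μ' ν)))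
    (hpos : ∀ ν, 0 < c ν ν)
    (μ : (n : ℕ) → Measure (Matrix.orthogonalGroup (Fin n ⊕ Fin n) ℝ))
    (hprob : ∀ n, IsProbabilityMeasure (μ n))
    (hinv : ∀ n, (μ n).IsMulLeftInvariant) :
    ∃ γ : Measure (Fin r → ℝ), IsGaussianMeasure γ 0 c ∧
      ∀ f : BoundedContinuousFunction (Fin r → ℝ) ℝ,
        Tendsto
          (fun n : ℕ => ∫ g, f (fun ν =>
            ((A ν n * ((g : Matrix (Fin n ⊕ Fin n) (Fin n ⊕ Fin n) ℝ)
              * (Jmat n)ᵀ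
              * (g : Matrix (Fin n ⊕ Fin n) (Fin n ⊕ Fin n) ℝ)ᵀ
              * Jmat n)).trace)) ∂ μ n)
          atTop (𝓝 (∫ x, f x ∂ γ)) := by
  classical
  have hpsd := DIII.c_posSemidef A c hc
  refine ⟨_, DIII.gaussian_isGaussianMeasure c hpsd, fun f => ?_⟩
  have hV : ∀ n, Continuous (fun g : Matrix.orthogonalGroup (Fin n ⊕ Fin n) ℝ =>
      (WithLp.toLp 2 (fun ν => ((Jmat n * A ν n) * DIII.XX (Jmat n)ᵀ g).trace) :
        EuclideanSpace ℝ (Fin r))) := by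
    intro n
    refine (PiLp.continuous_toLp 2 _).comp (continuous_pi fun ν => ?_)
    exact (DIII.cont_f _).comp (DIII.continuous_XX _)
  let L : ℕ → ProbabilityMeasure (EuclideanSpace ℝ (Fin r)) := fun n =>
    ⟨(μ n).map _, Measure.isProbabilityMeasure_map (hV n).measurable.aemeasurable⟩
  let L₀ : ProbabilityMeasure (EuclideanSpace ℝ (Fin r)) :=
    ⟨multivariateGaussian 0 c, inferInstance⟩
  have hL : Tendsto L atTop (𝓝 L₀) := by
    refine ProbabilityMeasure.tendsto_of_tendsto_charFun fun t => ?_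
    have h1 := DIII.clt (DIII.comb A t) (DIII.comb_skew A hA t) _
      (DIII.comb_tendsto A c hc t) μ hprob hinv
    have h2 : charFun (L₀ : Measure (EuclideanSpace ℝ (Fin r))) t =
        Complex.exp (-((∑ i, ∑ j, t i * c i j * t j) / 2 : ℝ)) := by
      change charFun (multivariateGaussian 0 c) t = _
      rw [charFun_multivariateGaussian hpsd, DIII.quad_form]
      simp
    rw [h2]
    refine h1.congr fun n => ?_
    change _ = charFun ((μ n).map _) t
    rw [charFun_apply, integral_map (hV n).measurable.aemeasurable (by fun_prop)]
    refine integral_congr_ae (ae_of_all _ fun g => ?_)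
    simp only [PiLp.inner_apply]
    rw [mul_comm Complex.I]
    congr 3
    simp only [DIII.comb, Finset.mul_sum, Finset.sum_mul, Matrix.mul_smul, Matrix.smul_mul,
      trace_sum, trace_smul, smul_eq_mul]
    refine Finset.sum_congr rfl fun i _ => ?_
    simp
  have hf := (ProbabilityMeasure.tendsto_iff_forall_integral_tendsto.mp hL)
    (f.compContinuous ⟨fun x : EuclideanSpace ℝ (Fin r) => (WithLp.ofLp x : Fin r → ℝ),
      PiLp.continuous_ofLp 2 _⟩)
  rw [integral_map (by fun_prop) f.continuous.aestronglyMeasurable]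
  refine hf.congr fun n => ?_
  change ∫ x, f (WithLp.ofLp x) ∂((μ n).map _) = _
  rw [integral_map (hV n).measurable.aemeasurable
    (show Continuous (fun x : EuclideanSpace ℝ (Fin r) => f (WithLp.ofLp x)) from
      f.continuous.comp (PiLp.continuous_ofLp 2 _)).aestronglyMeasurable]
  simp only [DIII.trace_AV]
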